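/- Let k ≥ 3 be an integer and let n be a nonzero integer. There do not exist positive integers a₁, a₂, a₃ and b₁, b₂, …, b₇ with a₁ < a₂ < a₃ ≤ b₁ < b₂ < ⋯ < b₇ and 2|n|^{17} ≤ b₁, such that a_i·b_j + n is a k-th power of a positive integer for all 1 ≤ i ≤ 3 and 1 ≤ j ≤ 7. -/

import Mathlib

section

open Finset

/-- The generalized binomial coefficient of a real number. -/
noncomputable def realChoose (c : ℝ) (e : ℕ) : ℝ := (∏ i ∈ range e, (c - i)) / e.factorial

lemma sum_neg_one_pow_choose_succ (n : ℕ) (f : ℕ → ℝ) :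
    ∑ i ∈ range (n + 2), (-1) ^ i * ((n + 1).choose i : ℝ) * f i =
      ∑ i ∈ range (n + 1), (-1) ^ i * (n.choose i : ℝ) * f i -
        ∑ i ∈ range (n + 1), (-1) ^ i * (n.choose i : ℝ) * f (i + 1) := by
  rw [sum_range_succ']
  simp only [Nat.choose_succ_succ', Nat.cast_add, mul_add, add_mul, sum_add_distrib]
  rw [sum_range_succ (fun i => (-1 : ℝ) ^ (i + 1) * (n.choose (i + 1) : ℝ) * f (i + 1)),
    sum_range_succ' (fun i => (-1 : ℝ) ^ i * (n.choose i : ℝ) * f i)]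
  simp [pow_succ, sum_neg_distrib]
  ring

lemma sum_neg_one_pow_choose_div (n : ℕ) (z : ℝ) (hz : ∀ i : ℕ, z + i ≠ 0) :
    ∑ i ∈ range (n + 1), (-1) ^ i * (n.choose i : ℝ) * (z + i)⁻¹ =
      n.factorial / ∏ i ∈ range (n + 1), (z + i) := by
  induction n generalizing z with
  | zero => simp
  | succ n ih =>
    have hz' : ∀ i : ℕ, z + 1 + i ≠ 0 := fun i => by
      have := hz (i + 1); push_cast at this; rwa [add_assoc, add_comm 1 (i : ℝ)]
    rw [sum_neg_one_pow_choose_succ n (fun i => (z + i)⁻¹), ih z hz]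
    have h1 := ih (z + 1) hz'
    have h2 : ∀ i : ℕ, (z + ((i + 1 : ℕ) : ℝ))⁻¹ = (z + 1 + i)⁻¹ := fun i => by
      push_cast; ring_nf
    simp only [h2]
    rw [h1]
    have h3 : ∏ i ∈ range (n + 2), (z + i) = z * ∏ i ∈ range (n + 1), (z + 1 + i) := by
      rw [prod_range_succ']
      simp only [Nat.cast_add, Nat.cast_one, Nat.cast_zero, add_zero]
      rw [mul_comm]
      congr 1
      exact prod_congr rfl fun i _ => by ring
    have h4 : ∏ i ∈ range (n + 2), (z + i) = (∏ i ∈ range (n + 1), (z + i)) * (z + (n + 1)) := by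
      rw [prod_range_succ]; push_cast; rfl
    have n1 : ∏ i ∈ range (n + 1), (z + i) ≠ 0 := prod_ne_zero_iff.2 fun i _ => hz i
    have n2 : ∏ i ∈ range (n + 1), (z + 1 + i) ≠ 0 := prod_ne_zero_iff.2 fun i _ => hz' i
    have n3 : z ≠ 0 := by simpa using hz 0
    have n4 : z + (n + 1) ≠ 0 := by have := hz (n + 1); push_cast at this; exact this
    rw [Nat.factorial_succ]
    have h5 : (∏ i ∈ range (n + 1), (z + 1 + i)) =
        (∏ i ∈ range (n + 1), (z + i)) * (z + (n + 1)) / z := by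
      rw [eq_div_iff n3, ← h4, h3]; ring
    rw [h3, h5]
    push_cast
    field_simp
    ring

lemma prod_div_factorial_eq (z : ℝ) (hz : ∀ i : ℕ, z + i ≠ 0) (e f g : ℕ) :
    ((e + f).choose e : ℝ) * (g.factorial / ∏ i ∈ range (g + 1), (z + e + i)) *
      ((∏ i ∈ range (e + f + g + 1), (z + i)) / ((e + f).factorial * g.factorial)) =
    (-1) ^ e * (realChoose (-z) e * realChoose (z + e + g + f) f) := by
  have h1 : e + f + g + 1 = e + ((g + 1) + f) := by ring
  have h2 : ∏ i ∈ range e, (z + i) = (-1) ^ e * ∏ i ∈ range e, (-z - i) := by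
    rw [← card_range e, ← prod_const, card_range, ← prod_mul_distrib]
    exact prod_congr rfl fun i _ => by ring
  have h3 : ∏ i ∈ range f, (z + (e + (g + 1 + i) : ℕ)) =
      ∏ i ∈ range f, (z + e + g + f - i) := by
    rw [← prod_range_reflect]
    refine prod_congr rfl fun i hi => ?_
    have := mem_range.1 hi
    have h : ((f - 1 - i : ℕ) : ℝ) = f - 1 - i := by
      rw [Nat.cast_sub (by omega), Nat.cast_sub (by omega)]; simp
    push_cast
    rw [h]; ring
  have n1 : ∏ i ∈ range (g + 1), (z + e + i) ≠ 0 := prod_ne_zero_iff.2 fun i _ => by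
    have := hz (e + i); push_cast at this; rwa [add_assoc]
  have h4 : ∏ i ∈ range (g + 1), (z + (e + i : ℕ)) = ∏ i ∈ range (g + 1), (z + e + i) :=
    prod_congr rfl fun i _ => by push_cast; ring
  have h5 : ((e + f).choose e : ℝ) * e.factorial * f.factorial = (e + f).factorial := by
    rw [Nat.choose_symm_add]; exact_mod_cast Nat.add_choose_mul_factorial_mul_factorial e f
  rw [h1, prod_range_add _ e, prod_range_add _ (g + 1), h2, h3, h4, ← h5]
  have hc : ((e + f).choose e : ℝ) ≠ 0 := by
    exact_mod_cast (Nat.choose_pos (Nat.le_add_right e f)).ne'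
  unfold realChoose
  field_simp

lemma realChoose_nonneg {c : ℝ} {e : ℕ} (h : (e : ℝ) ≤ c + 1) : 0 ≤ realChoose c e := by
  refine div_nonneg (prod_nonneg fun i hi => ?_) (by positivity)
  have : ((i + 1 : ℕ) : ℝ) ≤ e := by exact_mod_cast mem_range.1 hi
  push_cast at this
  linarith

lemma realChoose_le_choose {c : ℝ} {n e : ℕ} (h : (e : ℝ) ≤ c + 1) (hn : c ≤ n) :
    realChoose c e ≤ n.choose e := by
  have hen : e ≤ n + 1 := by exact_mod_cast (h.trans (by linarith) : (e : ℝ) ≤ n + 1)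
  rw [realChoose, div_le_iff₀ (by positivity)]
  have h1 : (n.choose e : ℝ) * e.factorial = n.descFactorial e := by
    rw [Nat.descFactorial_eq_factorial_mul_choose]; push_cast; ring
  rw [h1, Nat.descFactorial_eq_prod_range]
  push_cast
  refine prod_le_prod (fun i hi => ?_) fun i hi => ?_
  · have : ((i + 1 : ℕ) : ℝ) ≤ e := by exact_mod_cast mem_range.1 hi
    push_cast at this
    linarith
  · have := mem_range.1 hi
    rw [Nat.cast_sub (by omega)]
    linarith

lemma factorial_dvd_prod_sub (c : ℤ) (e : ℕ) : (e.factorial : ℤ) ∣ ∏ i ∈ range e, (c - i) := by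
  have h := Ring.descPochhammer_eq_factorial_smul_choose c e
  rw [← Polynomial.eval_eq_smeval, descPochhammer_eval_eq_prod_range] at h
  exact ⟨_, by simpa using h⟩

lemma factorial_dvd_pow_mul_prod (k : ℕ) (m : ℤ) (e : ℕ) :
    (e.factorial : ℤ) ∣ (k : ℤ) ^ e * ∏ i ∈ range e, (m - k * i) := by
  rw [Int.natCast_dvd, Nat.dvd_iff_prime_pow_dvd_dvd]
  intro p v hp hv
  rw [← Int.natCast_dvd]
  by_cases hpk : p ∣ k
  · have hve : v ≤ e := by
      have := Fact.mk hp
      exact ((padicValNat_dvd_iff_le e.factorial_ne_zero).1 hv).trans (padicValNat_factorial_le p e)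
    refine Dvd.dvd.mul_right ?_ _
    exact_mod_cast (pow_dvd_pow p hve).trans (pow_dvd_pow_of_dvd hpk e)
  · have hcop : IsCoprime (((p ^ v : ℕ) : ℤ)) (k : ℤ) :=
      Nat.isCoprime_iff_coprime.2 (Nat.Coprime.pow_left v ((Nat.Prime.coprime_iff_not_dvd hp).2 hpk))
    obtain ⟨s, c, hsc⟩ := hcop
    refine Dvd.dvd.mul_left ?_ _
    have hc : IsCoprime (((p ^ v : ℕ) : ℤ)) (c ^ e) :=
      IsCoprime.pow_right ⟨s, k, by linarith⟩
    refine hc.dvd_of_dvd_mul_left ?_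
    have h1 : c ^ e * ∏ i ∈ range e, (m - k * i) = ∏ i ∈ range e, (c * (m - k * i)) := by
      rw [prod_mul_distrib, prod_const, card_range]
    have h2 : ∏ i ∈ range e, (c * (m - k * i)) ≡ ∏ i ∈ range e, (c * m - i)
        [ZMOD ((p ^ v : ℕ) : ℤ)] := by
      refine Int.ModEq.prod fun i _ => ?_
      refine (Int.modEq_iff_dvd.2 ⟨-s * i, ?_⟩)
      linear_combination (i : ℤ) * hsc
    rw [h1]
    exact (Int.ModEq.dvd_iff h2).2
      ((Int.natCast_dvd_natCast.2 hv).trans (factorial_dvd_prod_sub _ e))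

lemma exists_int_eq_pow_mul_realChoose {k : ℕ} (hk : k ≠ 0) (m : ℤ) (e : ℕ) :
    ∃ z : ℤ, (z : ℝ) = (k : ℝ) ^ (2 * e) * realChoose (m / k) e := by
  obtain ⟨z, hz⟩ := factorial_dvd_pow_mul_prod k m e
  refine ⟨z, ?_⟩
  have hk' : (k : ℝ) ≠ 0 := by exact_mod_cast hk
  have h1 : (k : ℝ) ^ e * ∏ i ∈ range e, ((m : ℝ) - k * i) = e.factorial * z := by exact_mod_cast hz
  have h2 : ∏ i ∈ range e, ((m : ℝ) - k * i) = k ^ e * ∏ i ∈ range e, ((m : ℝ) / k - i) := by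
    nth_rewrite 2 [← card_range e]
    rw [← prod_const, ← prod_mul_distrib]
    exact prod_congr rfl fun i _ => by field_simp
  rw [realChoose, mul_div_assoc', eq_div_iff (by positivity), mul_comm (z : ℝ), ← h1, h2, two_mul,
    pow_add, mul_assoc]

/-- Numerator of the `[p + 1 / p]` Padé approximant of `x ^ (1 / k)` at `1`. -/
noncomputable def padeNum (k p : ℕ) (x : ℝ) : ℝ :=
  ∑ i ∈ range (p + 2),
    realChoose (p + 1 - 1 / k) i * realChoose (p + 1 / k) (p + 1 - i) * x ^ (p + 1 - i)

/-- Denominator of the `[p + 1 / p]` Padé approximant of `x ^ (1 / k)` at `1`. -/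
noncomputable def padeDen (k p : ℕ) (x : ℝ) : ℝ :=
  ∑ l ∈ range (p + 1), realChoose (p + 1 - 1 / k) l * realChoose (p + 1 / k) (p - l) * x ^ l

lemma inv_natCast_sub_add_ne_zero {k : ℕ} (hk : 2 ≤ k) (p i : ℕ) :
    (1 / k - (p + 1) : ℝ) + i ≠ 0 := by
  intro h
  have hk' : (k : ℝ) ≠ 0 := by positivity
  have h1 : (1 : ℝ) = k * (p + 1 - i) := by field_simp at h; linarith
  have h2 : (1 : ℤ) = k * (p + 1 - i) := by exact_mod_cast h1
  have h3 : (k : ℤ) ∣ 1 := ⟨_, h2⟩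
  have h4 := Int.le_of_dvd one_pos h3
  omega

lemma integral_pade_eq_sum {k : ℕ} (hk : 2 ≤ k) (p : ℕ) {ξ : ℝ} (hξ : 1 ≤ ξ) :
    ∫ t in (1 : ℝ)..ξ, k * ((t ^ k - 1) ^ p * (ξ ^ k - t ^ k) ^ (p + 1) * (t ^ (k * (p + 1)))⁻¹) =
      ∑ i ∈ range (p + 2), ∑ l ∈ range (p + 1),
        (-1) ^ i * ((p + 1).choose i : ℝ) * ((-1) ^ (p - l) * (p.choose l : ℝ)) *
          (ξ * (ξ ^ k) ^ l - (ξ ^ k) ^ (p + 1 - i)) * ((1 / k - (p + 1) : ℝ) + i + l)⁻¹ := by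
  have h0 : (0 : ℝ) ∉ Set.uIcc 1 ξ := by
    rw [Set.uIcc_of_le hξ]; exact fun h => by linarith [h.1]
  have hk' : (k : ℝ) ≠ 0 := by positivity
  have hξ0 : ξ ≠ 0 := by positivity
  have h1 : ∀ t ∈ Set.uIcc 1 ξ,
      k * ((t ^ k - 1) ^ p * (ξ ^ k - t ^ k) ^ (p + 1) * (t ^ (k * (p + 1)))⁻¹) =
      ∑ i ∈ range (p + 2), ∑ l ∈ range (p + 1),
        (-1) ^ i * ((p + 1).choose i : ℝ) * ((-1) ^ (p - l) * (p.choose l : ℝ)) *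
          (k * (ξ ^ k) ^ (p + 1 - i)) * t ^ ((k : ℤ) * (i + l) - k * (p + 1)) := by
    intro t ht
    have ht0 : t ≠ 0 := fun h => h0 (h ▸ ht)
    rw [sub_eq_add_neg (t ^ k), add_pow, sub_eq_neg_add, add_pow, sum_mul_sum, sum_comm, sum_mul,
      mul_sum]
    refine sum_congr rfl fun i _ => ?_
    rw [sum_mul, mul_sum]
    refine sum_congr rfl fun l _ => ?_
    have h2 : t ^ ((k : ℤ) * (i + l) - k * (p + 1)) =
        (t ^ k) ^ i * (t ^ k) ^ l * (t ^ (k * (p + 1)))⁻¹ := by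
      rw [zpow_sub₀ ht0, mul_add, zpow_add₀ ht0, div_eq_mul_inv, ← pow_mul, ← pow_mul]
      norm_cast
    rw [h2, neg_pow (t ^ k) i]
    ring
  have hint : ∀ n : ℤ, IntervalIntegrable (fun t : ℝ => t ^ n) MeasureTheory.volume 1 ξ := fun n =>
    intervalIntegral.intervalIntegrable_zpow (Or.inr h0)
  rw [intervalIntegral.integral_congr h1, intervalIntegral.integral_finsetSum]
  swap
  · intro i _
    have h := IntervalIntegrable.sum (range (p + 1)) fun l (_ : l ∈ range (p + 1)) =>
      (hint ((k : ℤ) * (i + l) - k * (p + 1))).const_mul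
        ((-1) ^ i * ((p + 1).choose i : ℝ) * ((-1) ^ (p - l) * (p.choose l : ℝ)) *
          (k * (ξ ^ k) ^ (p + 1 - i)))
    simpa only [sum_fn] using h
  refine sum_congr rfl fun i hi => ?_
  rw [intervalIntegral.integral_finsetSum fun l _ => (hint _).const_mul _]
  refine sum_congr rfl fun l _ => ?_
  have hz := inv_natCast_sub_add_ne_zero hk p (i + l)
  push_cast at hz
  have hz1 : ((k : ℝ) * (i + l) - k * (p + 1) + 1) = k * (1 / k - (p + 1) + i + l) := by
    field_simp; ring
  have hz2 : ((k : ℝ) * (i + l) - k * (p + 1) + 1) ≠ 0 := by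
    rw [hz1, add_assoc]; exact mul_ne_zero hk' hz
  rw [intervalIntegral.integral_const_mul, integral_zpow (Or.inr ⟨fun h => hz2 ?_, h0⟩)]
  swap
  · have : ((k : ℤ) * (i + l) - k * (p + 1) + 1) = 0 := by rw [h]; rfl
    exact_mod_cast this
  push_cast
  rw [hz1, one_zpow]
  have hi' : i ≤ p + 1 := by have := mem_range.1 hi; omega
  have h3 : (ξ ^ k) ^ (p + 1 - i) * ξ ^ ((k : ℤ) * (i + l) - k * (p + 1) + 1) = ξ * (ξ ^ k) ^ l := by
    rw [← pow_mul, ← pow_mul, ← zpow_natCast, ← zpow_natCast ξ (k * l), ← zpow_add₀ hξ0,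
      ← zpow_one_add₀ hξ0]
    congr 1
    push_cast [Nat.cast_sub hi']
    ring
  rw [← h3]
  have hz3 : (1 / k - (p + 1) : ℝ) + i + l ≠ 0 := by rw [add_assoc]; exact hz
  field_simp

/-- Integral formula for the remainder of the Padé approximant of `x ^ (1 / k)`, where `x = ξ ^ k`. -/
lemma padeNum_sub_eq_integral {k : ℕ} (hk : 2 ≤ k) (p : ℕ) {ξ : ℝ} (hξ : 1 ≤ ξ) :
    padeNum k p (ξ ^ k) - ξ * padeDen k p (ξ ^ k) =
      (-1) ^ (p + 1) * ((∏ i ∈ range (2 * p + 2), ((1 / k - (p + 1) : ℝ) + i)) /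
        ((p + 1).factorial * p.factorial)) *
      ∫ t in (1 : ℝ)..ξ,
        k * ((t ^ k - 1) ^ p * (ξ ^ k - t ^ k) ^ (p + 1) * (t ^ (k * (p + 1)))⁻¹) := by
  rw [integral_pade_eq_sum hk p hξ]
  set z : ℝ := 1 / k - (p + 1) with hz
  have hz0 : ∀ i : ℕ, z + i ≠ 0 := inv_natCast_sub_add_ne_zero hk p
  set c : ℝ := (∏ i ∈ range (2 * p + 2), (z + i)) / ((p + 1).factorial * p.factorial) with hc
  have hsq : ∀ n : ℕ, ((-1 : ℝ) ^ n) * (-1) ^ n = 1 := fun n => by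
    rw [← mul_pow]; simp
  have hA : padeDen k p (ξ ^ k) = (-1) ^ p * c * ∑ l ∈ range (p + 1), ∑ i ∈ range (p + 2),
      (-1) ^ i * ((p + 1).choose i : ℝ) * ((-1) ^ (p - l) * (p.choose l : ℝ)) *
        (ξ ^ k) ^ l * (z + i + l)⁻¹ := by
    rw [padeDen, mul_sum]
    refine sum_congr rfl fun l hl => ?_
    obtain ⟨f, rfl⟩ := Nat.exists_eq_add_of_le (Nat.lt_succ_iff.1 (mem_range.1 hl))
    have h1 := sum_neg_one_pow_choose_div (l + f + 1) (z + l) fun i => by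
      have := hz0 (l + i); push_cast at this; rwa [add_assoc]
    have h2 := prod_div_factorial_eq z hz0 l f (l + f + 1)
    rw [← h1, show l + f + (l + f + 1) + 1 = 2 * (l + f) + 2 by ring,
      mul_comm ((l + f).factorial : ℝ), ← hc] at h2
    have h3 : z + l + ((l + f + 1 : ℕ) : ℝ) + f = ((l + f : ℕ) : ℝ) + 1 / k := by
      rw [hz]; push_cast; ring
    have h4 : -z = ((l + f : ℕ) : ℝ) + 1 - 1 / k := by rw [hz]; ring
    rw [h3, h4] at h2
    have h5 : ∑ i ∈ range (l + f + 2), (-1) ^ i * ((l + f + 1).choose i : ℝ) *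
        ((-1) ^ (l + f - l) * ((l + f).choose l : ℝ)) * (ξ ^ k) ^ l * (z + i + l)⁻¹ =
        (-1) ^ f * ((l + f).choose l : ℝ) * (ξ ^ k) ^ l *
        ∑ i ∈ range (l + f + 1 + 1), (-1) ^ i * ((l + f + 1).choose i : ℝ) * (z + l + i)⁻¹ := by
      rw [mul_sum, Nat.add_sub_cancel_left]
      refine sum_congr rfl fun i _ => ?_
      rw [add_right_comm]; ring
    rw [h5, Nat.add_sub_cancel_left]
    have h6 := hsq l
    have h7 := hsq f
    rw [pow_add]
    linear_combination (-(ξ ^ k) ^ l * (-1) ^ l * ((-1) ^ f * (-1) ^ f)) * h2 -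
      (ξ ^ k) ^ l * realChoose (((l + f : ℕ) : ℝ) + 1 - 1 / k) l *
        realChoose (((l + f : ℕ) : ℝ) + 1 / k) f * ((-1) ^ l * (-1) ^ l * h7 + h6)
  have hB : padeNum k p (ξ ^ k) = (-1) ^ p * c * ∑ i ∈ range (p + 2), ∑ l ∈ range (p + 1),
      (-1) ^ i * ((p + 1).choose i : ℝ) * ((-1) ^ (p - l) * (p.choose l : ℝ)) *
        (ξ ^ k) ^ (p + 1 - i) * (z + i + l)⁻¹ := by
    rw [padeNum, mul_sum]
    refine sum_congr rfl fun i hi => ?_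
    obtain ⟨f, hf⟩ := Nat.exists_eq_add_of_le (Nat.lt_succ_iff.1 (mem_range.1 hi))
    have h1 := sum_neg_one_pow_choose_div p (z + i) fun l => by
      have := hz0 (i + l); push_cast at this; rwa [add_assoc]
    have h2 := prod_div_factorial_eq z hz0 i f p
    rw [← h1, ← hf, show p + 1 + p + 1 = 2 * p + 2 by ring, ← hc] at h2
    have hf' : (p : ℝ) + 1 = i + f := by exact_mod_cast hf
    have h3 : z + i + p + f = p + 1 / k := by
      rw [hz]; linear_combination -hf'
    have h4 : -z = p + 1 - 1 / k := by rw [hz]; ring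
    rw [h3, h4] at h2
    have h5 : ∑ l ∈ range (p + 1), (-1) ^ i * ((p + 1).choose i : ℝ) *
        ((-1) ^ (p - l) * (p.choose l : ℝ)) * (ξ ^ k) ^ (p + 1 - i) * (z + i + l)⁻¹ =
        (-1) ^ i * ((p + 1).choose i : ℝ) * (ξ ^ k) ^ (p + 1 - i) * ((-1) ^ p *
        ∑ l ∈ range (p + 1), (-1) ^ l * (p.choose l : ℝ) * (z + i + l)⁻¹) := by
      rw [mul_sum, mul_sum]
      refine sum_congr rfl fun l hl => ?_
      have h8 : (-1 : ℝ) ^ (p - l) = (-1) ^ p * (-1) ^ l := by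
        obtain ⟨m, rfl⟩ := Nat.exists_eq_add_of_le (Nat.lt_succ_iff.1 (mem_range.1 hl))
        rw [Nat.add_sub_cancel_left, pow_add]
        linear_combination (-(-1 : ℝ) ^ m) * hsq l
      rw [h8]; ring
    rw [h5, show p + 1 - i = f by omega]
    have h6 := hsq i
    have h7 := hsq p
    linear_combination (-(ξ ^ k) ^ f * (-1) ^ i * ((-1) ^ p * (-1) ^ p)) * h2 -
      (ξ ^ k) ^ f * realChoose (p + 1 - 1 / k) i *
        realChoose (p + 1 / k) f * ((-1) ^ i * (-1) ^ i * h7 + h6)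
  rw [hA, sum_comm, hB]
  have hsplit : ∀ S T : ℝ, (-1) ^ p * c * S - ξ * ((-1) ^ p * c * T) =
      (-1) ^ (p + 1) * c * (ξ * T - S) := fun S T => by rw [pow_succ]; ring
  rw [hsplit, mul_sum, ← sum_sub_distrib]
  congr 1
  refine sum_congr rfl fun i _ => ?_
  rw [mul_sum, ← sum_sub_distrib]
  exact sum_congr rfl fun l _ => by ring

lemma padeConst_eq (ν : ℝ) (p : ℕ) :
    (-1) ^ (p + 1) * (∏ i ∈ range (2 * p + 2), (ν - (p + 1) + i)) =
      (p + 1 - ν) * ν * ∏ i ∈ range p, ((i + 1 - ν) * (i + 1 + ν)) := by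
  have h1 : (-1) ^ (p + 1) * ∏ i ∈ range (p + 1), (ν - (p + 1) + i) =
      ∏ i ∈ range (p + 1), ((i : ℝ) + 1 - ν) := by
    rw [← prod_range_reflect, ← card_range (p + 1), ← prod_const, card_range, ← prod_mul_distrib]
    refine prod_congr rfl fun i hi => ?_
    have := mem_range.1 hi
    rw [show p + 1 - 1 - i = p - i by omega, Nat.cast_sub (by omega)]
    ring
  have h2 : ∏ i ∈ range (p + 1), (ν - (p + 1) + ((p + 1 + i : ℕ) : ℝ)) =
      ν * ∏ i ∈ range p, ((i : ℝ) + 1 + ν) := by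
    rw [prod_range_succ', mul_comm]
    congr 1
    · push_cast; ring
    · exact prod_congr rfl fun i _ => by push_cast; ring
  rw [show 2 * p + 2 = (p + 1) + (p + 1) by ring, prod_range_add, ← mul_assoc, h1, h2,
    prod_range_succ, prod_mul_distrib]
  ring

lemma padeConst_bounds {ν : ℝ} (h0 : 0 ≤ ν) (h1 : ν ≤ 1) (p : ℕ) :
    0 ≤ (-1) ^ (p + 1) * ((∏ i ∈ range (2 * p + 2), (ν - (p + 1) + i)) /
        ((p + 1).factorial * p.factorial)) ∧
    (-1) ^ (p + 1) * ((∏ i ∈ range (2 * p + 2), (ν - (p + 1) + i)) /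
        ((p + 1).factorial * p.factorial)) ≤ ν := by
  have hp : ∀ i : ℕ, (0 : ℝ) ≤ i := fun i => i.cast_nonneg
  have hpos : 0 ≤ ∏ i ∈ range p, (((i : ℝ) + 1 - ν) * (i + 1 + ν)) :=
    prod_nonneg fun i _ => mul_nonneg (by linarith [hp i]) (by linarith [hp i])
  have hle : ∏ i ∈ range p, (((i : ℝ) + 1 - ν) * (i + 1 + ν)) ≤ p.factorial * p.factorial := by
    have hf : (p.factorial : ℝ) = ∏ i ∈ range p, ((i : ℝ) + 1) := by
      rw [← prod_range_add_one_eq_factorial]; push_cast; rfl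
    rw [hf, ← prod_mul_distrib]
    exact prod_le_prod (fun i _ => mul_nonneg (by linarith [hp i]) (by linarith [hp i]))
      fun i _ => by nlinarith [hp i]
  have hfp : (0 : ℝ) < (p + 1).factorial * p.factorial := by positivity
  rw [mul_div_assoc', padeConst_eq]
  have h2 : 0 ≤ (p + 1 - ν) * ν := mul_nonneg (by linarith [hp p]) h0
  refine ⟨div_nonneg (mul_nonneg h2 hpos) hfp.le, (div_le_iff₀ hfp).2 ?_⟩
  have h3 : ((p + 1).factorial : ℝ) = (p + 1) * p.factorial := by
    rw [Nat.factorial_succ]; push_cast; ring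
  calc _ ≤ (p + 1 - ν) * ν * (p.factorial * p.factorial) := mul_le_mul_of_nonneg_left hle h2
    _ ≤ ((p + 1) * ν) * (p.factorial * p.factorial) := by
      refine mul_le_mul_of_nonneg_right ?_ (by positivity)
      nlinarith
    _ = _ := by rw [h3]; ring

lemma padeNum_sub_mem {k : ℕ} (hk : 2 ≤ k) (p : ℕ) {ξ : ℝ} (hξ : 1 ≤ ξ) :
    0 ≤ padeNum k p (ξ ^ k) - ξ * padeDen k p (ξ ^ k) ∧
    padeNum k p (ξ ^ k) - ξ * padeDen k p (ξ ^ k) ≤ 2 * ((ξ ^ k - 1) ^ 2 / 4) ^ (p + 1) := by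
  have hk2 : (2 : ℝ) ≤ k := by exact_mod_cast hk
  have hν1 : (1 : ℝ) / k ≤ 1 / 2 := by
    apply one_div_le_one_div_of_le <;> linarith
  obtain ⟨hc0, hc1⟩ := padeConst_bounds (ν := 1 / k) (by positivity) (by linarith) p
  rw [padeNum_sub_eq_integral hk p hξ]
  set c := (-1 : ℝ) ^ (p + 1) * ((∏ i ∈ range (2 * p + 2), ((1 / k - (p + 1) : ℝ) + i)) /
        ((p + 1).factorial * p.factorial))
  set x := ξ ^ k with hx
  have hx1 : 1 ≤ x := one_le_pow₀ hξ
  have hfac : ∀ t ∈ Set.Icc 1 ξ, 0 ≤ t ^ k - 1 ∧ 0 ≤ x - t ^ k ∧ 0 ≤ (t ^ (k * (p + 1)))⁻¹ ∧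
      (t ^ (k * (p + 1)))⁻¹ ≤ 1 := fun t ht =>
    ⟨sub_nonneg.2 (one_le_pow₀ ht.1),
      sub_nonneg.2 (pow_le_pow_left₀ (zero_le_one.trans ht.1) ht.2 k),
      inv_nonneg.2 (pow_nonneg (zero_le_one.trans ht.1) _), inv_le_one_of_one_le₀ (one_le_pow₀ ht.1)⟩
  have hI0 : 0 ≤ ∫ t in (1 : ℝ)..ξ,
      k * ((t ^ k - 1) ^ p * (x - t ^ k) ^ (p + 1) * (t ^ (k * (p + 1)))⁻¹) :=
    intervalIntegral.integral_nonneg hξ fun t ht => by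
      obtain ⟨h1, h2, h3, -⟩ := hfac t ht
      positivity
  have hI1 : ∫ t in (1 : ℝ)..ξ,
      k * ((t ^ k - 1) ^ p * (x - t ^ k) ^ (p + 1) * (t ^ (k * (p + 1)))⁻¹) ≤
      4 * ((x - 1) ^ 2 / 4) ^ (p + 1) := by
    have h := intervalIntegral.norm_integral_le_of_norm_le_const (a := 1) (b := ξ)
      (f := fun t => k * ((t ^ k - 1) ^ p * (x - t ^ k) ^ (p + 1) * (t ^ (k * (p + 1)))⁻¹))
      (C := k * (((x - 1) ^ 2 / 4) ^ p * (x - 1))) fun t ht => by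
        rw [Set.uIoc_of_le hξ] at ht
        obtain ⟨h1, h2, h3, h4⟩ := hfac t ⟨ht.1.le, ht.2⟩
        rw [Real.norm_of_nonneg (by positivity)]
        refine mul_le_mul_of_nonneg_left ?_ (by positivity)
        calc _ ≤ (t ^ k - 1) ^ p * (x - t ^ k) ^ (p + 1) * 1 := by gcongr
          _ = ((t ^ k - 1) * (x - t ^ k)) ^ p * (x - t ^ k) := by rw [mul_pow, pow_succ]; ring
          _ ≤ _ := by
            gcongr
            · nlinarith [sq_nonneg ((t ^ k - 1) - (x - t ^ k))]
            · linarith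
    refine (le_abs_self _).trans (h.trans ?_)
    rw [abs_of_nonneg (by linarith)]
    have hb : k * (ξ - 1) ≤ x - 1 := by
      have := one_add_mul_le_pow (a := ξ - 1) (by linarith) k
      rw [add_sub_cancel] at this
      linarith
    have h5 : 0 ≤ ((x - 1) ^ 2 / 4) ^ p * (x - 1) := mul_nonneg (by positivity) (by linarith)
    calc _ = ((x - 1) ^ 2 / 4) ^ p * (x - 1) * (k * (ξ - 1)) := by ring
      _ ≤ ((x - 1) ^ 2 / 4) ^ p * (x - 1) * (x - 1) := mul_le_mul_of_nonneg_left hb h5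
      _ = _ := by rw [pow_succ]; ring
  refine ⟨mul_nonneg hc0 hI0, ?_⟩
  calc _ ≤ (1 / 2 : ℝ) * (4 * ((x - 1) ^ 2 / 4) ^ (p + 1)) :=
        mul_le_mul (hc1.trans hν1) hI1 hI0 (by norm_num)
    _ = _ := by ring

lemma padeDen_nonneg {k : ℕ} (hk : 1 ≤ k) (p : ℕ) {x : ℝ} (hx : 0 ≤ x) :
    0 ≤ padeDen k p x := by
  have hν0 : (0 : ℝ) ≤ 1 / k := by positivity
  have hν1 : (1 : ℝ) / k ≤ 1 := by
    rw [div_le_one (by positivity)]; exact_mod_cast hk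
  refine sum_nonneg fun l hl => mul_nonneg (mul_nonneg ?_ ?_) (pow_nonneg hx _)
  · refine realChoose_nonneg ?_
    have : (l : ℝ) ≤ p := by exact_mod_cast Nat.lt_succ_iff.1 (mem_range.1 hl)
    linarith
  · refine realChoose_nonneg ?_
    have : ((p - l : ℕ) : ℝ) ≤ p := by exact_mod_cast Nat.sub_le p l
    linarith

lemma padeNum_pos {k : ℕ} (hk : 1 ≤ k) (p : ℕ) {x : ℝ} (hx : 0 < x) :
    0 < padeNum k p x := by
  have hν0 : (0 : ℝ) ≤ 1 / k := by positivity
  have hν1 : (1 : ℝ) / k ≤ 1 := by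
    rw [div_le_one (by positivity)]; exact_mod_cast hk
  have h1 : ∀ i ∈ range (p + 2), 0 ≤ realChoose (p + 1 - 1 / k) i *
      realChoose (p + 1 / k) (p + 1 - i) * x ^ (p + 1 - i) := fun l hl => by
    refine mul_nonneg (mul_nonneg ?_ ?_) (pow_nonneg hx.le _)
    · refine realChoose_nonneg ?_
      have : (l : ℝ) ≤ (p + 1 : ℕ) := by exact_mod_cast Nat.lt_succ_iff.1 (mem_range.1 hl)
      push_cast at this
      linarith
    · refine realChoose_nonneg ?_
      have : ((p + 1 - l : ℕ) : ℝ) ≤ (p + 1 : ℕ) := by exact_mod_cast Nat.sub_le (p + 1) l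
      push_cast at this
      linarith
  have hν : (0 : ℝ) < 1 / k := by positivity
  refine lt_of_lt_of_le ?_ (single_le_sum h1 (mem_range.2 (Nat.succ_pos (p + 1))))
  simp only [realChoose, range_zero, prod_empty, Nat.sub_zero]
  refine mul_pos (mul_pos (by norm_num) (div_pos (prod_pos fun i hi => ?_) (by positivity)))
    (pow_pos hx _)
  have : (i : ℝ) ≤ p := by exact_mod_cast Nat.lt_succ_iff.1 (mem_range.1 hi)
  linarith

lemma padeDen_le {k : ℕ} (hk : 1 ≤ k) (p : ℕ) {x : ℝ} (hx : 1 ≤ x) :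
    padeDen k p x ≤ (4 * x) ^ (p + 1) := by
  have hν0 : (0 : ℝ) ≤ 1 / k := by positivity
  have hν1 : (1 : ℝ) / k ≤ 1 := by
    rw [div_le_one (by positivity)]; exact_mod_cast hk
  have h1 : padeDen k p x ≤
      ∑ l ∈ range (p + 1), ((p + 1).choose l : ℝ) * ((p + 1).choose (p - l) : ℝ) * x ^ (p + 1) := by
    refine sum_le_sum fun l hl => ?_
    have h2 : (l : ℝ) ≤ p := by exact_mod_cast Nat.lt_succ_iff.1 (mem_range.1 hl)
    have h3 : ((p - l : ℕ) : ℝ) ≤ p := by exact_mod_cast Nat.sub_le p l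
    have h4 : x ^ l ≤ x ^ (p + 1) := pow_le_pow_right₀ hx (mem_range.1 hl).le
    have h5 : realChoose (p + 1 - 1 / k) l ≤ (p + 1).choose l :=
      realChoose_le_choose (by linarith) (by push_cast; linarith)
    have h6 : realChoose (p + 1 / k) (p - l) ≤ (p + 1).choose (p - l) :=
      realChoose_le_choose (by linarith) (by push_cast; linarith)
    have h7 : 0 ≤ realChoose (p + 1 / k) (p - l) := realChoose_nonneg (by linarith)
    exact mul_le_mul (mul_le_mul h5 h6 h7 (by positivity)) h4 (by positivity) (by positivity)
  have h2 : ∑ l ∈ range (p + 1), (p + 1).choose l * (p + 1).choose (p - l) ≤ 4 ^ (p + 1) := by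
    have h := Nat.add_choose_eq (p + 1) (p + 1) p
    rw [Nat.sum_antidiagonal_eq_sum_range_succ_mk] at h
    rw [← h, show (4 : ℕ) = 2 ^ 2 by norm_num, ← pow_mul]
    exact (Nat.choose_le_two_pow _ _).trans (Nat.pow_le_pow_right (by norm_num) (by omega))
  rw [← sum_mul] at h1
  refine h1.trans ?_
  rw [mul_pow]
  refine mul_le_mul_of_nonneg_right ?_ (by positivity)
  exact_mod_cast h2

lemma exists_int_eq_padeNum {k : ℕ} (hk : k ≠ 0) (p u v : ℕ) (hu : u ≠ 0) :
    ∃ z : ℤ, (z : ℝ) = (k : ℝ) ^ (2 * (p + 1)) * u ^ (p + 1) * padeNum k p (v / u) := by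
  have hk' : (k : ℝ) ≠ 0 := by exact_mod_cast hk
  have hu' : (u : ℝ) ≠ 0 := by exact_mod_cast hu
  choose f hf using exists_int_eq_pow_mul_realChoose hk (k * (p + 1) - 1)
  choose g hg using exists_int_eq_pow_mul_realChoose hk (k * p + 1)
  refine ⟨∑ i ∈ range (p + 2), f i * g (p + 1 - i) * u ^ i * v ^ (p + 1 - i), ?_⟩
  rw [padeNum, mul_sum]
  push_cast
  refine sum_congr rfl fun i hi => ?_
  have h1 : ((k * (p + 1) - 1 : ℤ) : ℝ) / k = p + 1 - 1 / k := by push_cast; field_simp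
  have h2 : ((k * p + 1 : ℤ) : ℝ) / k = p + 1 / k := by push_cast; field_simp
  rw [hf, hg, h1, h2]
  obtain ⟨j, hj⟩ := Nat.exists_eq_add_of_le (Nat.lt_succ_iff.1 (mem_range.1 hi))
  rw [hj, Nat.add_sub_cancel_left, div_pow, mul_add 2, pow_add _ (2 * i), pow_add _ i]
  field_simp

lemma exists_int_eq_padeDen {k : ℕ} (hk : k ≠ 0) (p u v : ℕ) (hu : u ≠ 0) :
    ∃ z : ℤ, (z : ℝ) = (k : ℝ) ^ (2 * (p + 1)) * u ^ (p + 1) * padeDen k p (v / u) := by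
  have hk' : (k : ℝ) ≠ 0 := by exact_mod_cast hk
  have hu' : (u : ℝ) ≠ 0 := by exact_mod_cast hu
  choose f hf using exists_int_eq_pow_mul_realChoose hk (k * (p + 1) - 1)
  choose g hg using exists_int_eq_pow_mul_realChoose hk (k * p + 1)
  refine ⟨∑ l ∈ range (p + 1), k ^ 2 * f l * g (p - l) * u ^ (p - l + 1) * v ^ l, ?_⟩
  rw [padeDen, mul_sum]
  push_cast
  refine sum_congr rfl fun l hl => ?_
  have h1 : ((k * (p + 1) - 1 : ℤ) : ℝ) / k = p + 1 - 1 / k := by push_cast; field_simp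
  have h2 : ((k * p + 1 : ℤ) : ℝ) / k = p + 1 / k := by push_cast; field_simp
  rw [hf, hg, h1, h2]
  obtain ⟨j, hj⟩ := Nat.exists_eq_add_of_le (Nat.lt_succ_iff.1 (mem_range.1 hl))
  have h3 : ∀ c : ℝ, c ^ (p + 1) = c ^ l * c ^ (j + 1) := fun c => by rw [hj, ← pow_add, add_assoc]
  rw [h3, show p - l = j by omega, div_pow, show 2 * (p + 1) = 2 + (2 * l + 2 * j) by omega,
    pow_add _ 2, pow_add _ (2 * l)]
  field_simp

/-- A nonzero integer built from a Padé approximant to the `k`-th root of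
`a' * x ^ k / (a * x' ^ k)` forces one of two explicit quantities not to be small. -/
lemma one_le_add_of_mul_add_eq_pow {k : ℕ} (hk : 2 ≤ k) (p : ℕ) {a a' b B x x' y y' : ℕ} {n : ℤ}
    (ha : 0 < a) (ha' : 0 < a') (hx0 : 0 < x) (hx0' : 0 < x') (hy0 : 0 < y) (hy0' : 0 < y')
    (hx : (a * b : ℤ) + n = (x : ℤ) ^ k) (hx' : (a' * b : ℤ) + n = (x' : ℤ) ^ k)
    (hy : (a * B : ℤ) + n = (y : ℤ) ^ k) (hy' : (a' * B : ℤ) + n = (y' : ℤ) ^ k)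
    {δ : ℝ} (hδ : δ = n * ((a' : ℝ) - a)) (hδ0 : 0 < δ) :
    1 ≤ (4 * k ^ 2 * (a' * (x : ℝ) ^ k)) ^ (p + 1) * (x * δ / (a * (y' : ℝ) ^ (k - 1))) +
      2 * (k ^ 2 * δ ^ 2 / (4 * (a * (x' : ℝ) ^ k))) ^ (p + 1) * (y * x') := by
  have hk0 : k ≠ 0 := by omega
  have ra : (0 : ℝ) < a := by exact_mod_cast ha
  have ra' : (0 : ℝ) < a' := by exact_mod_cast ha'
  have rx : (0 : ℝ) < x := by exact_mod_cast hx0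
  have rx' : (0 : ℝ) < x' := by exact_mod_cast hx0'
  have ry : (0 : ℝ) < y := by exact_mod_cast hy0
  have ry' : (0 : ℝ) < y' := by exact_mod_cast hy0'
  have ex : (a * b : ℝ) + n = (x : ℝ) ^ k := by exact_mod_cast hx
  have ex' : (a' * b : ℝ) + n = (x' : ℝ) ^ k := by exact_mod_cast hx'
  have ey : (a * B : ℝ) + n = (y : ℝ) ^ k := by exact_mod_cast hy
  have ey' : (a' * B : ℝ) + n = (y' : ℝ) ^ k := by exact_mod_cast hy'
  have hu0 : a * x' ^ k ≠ 0 := by positivity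
  obtain ⟨z₁, hz₁⟩ := exists_int_eq_padeNum hk0 p (a * x' ^ k) (a' * x ^ k) hu0
  obtain ⟨z₂, hz₂⟩ := exists_int_eq_padeDen hk0 p (a * x' ^ k) (a' * x ^ k) hu0
  push_cast at hz₁ hz₂
  set u : ℝ := a * (x' : ℝ) ^ k with hu
  set v : ℝ := a' * (x : ℝ) ^ k with hv
  have hupos : 0 < u := by positivity
  have hvu : v - u = δ := by rw [hv, hu, ← ex, ← ex', hδ]; ring
  have hvu1 : 1 ≤ v / u := (one_le_div hupos).2 (by linarith)
  obtain ⟨ξ, hξ1, hξ⟩ : ∃ ξ : ℝ, 1 ≤ ξ ∧ ξ ^ k = v / u :=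
    ⟨(v / u) ^ ((k : ℝ)⁻¹), Real.one_le_rpow hvu1 (by positivity),
      Real.rpow_inv_natCast_pow (by linarith) hk0⟩
  obtain ⟨hr0, hr1⟩ := padeNum_sub_mem hk p hξ1
  rw [hξ] at hr0 hr1
  have hd0 := padeDen_nonneg (by omega : 1 ≤ k) p (by linarith : 0 ≤ v / u)
  have hd1 := padeDen_le (by omega : 1 ≤ k) p hvu1
  have hn0 := padeNum_pos (by omega : 1 ≤ k) p (by linarith : 0 < v / u)
  set num := padeNum k p (v / u)
  set den := padeDen k p (v / u)
  set X : ℝ := ξ * (y * x') with hX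
  set Y : ℝ := y' * x with hY
  have hX0 : 0 < X := by positivity
  have hY0 : 0 < Y := by positivity
  have hXY : X ^ k - Y ^ k = (x : ℝ) ^ k * δ / a := by
    have h1 : (a' : ℝ) * (y : ℝ) ^ k - a * (y' : ℝ) ^ k = δ := by rw [← ey, ← ey', hδ]; ring
    rw [hX, hY, mul_pow, hξ, ← h1, mul_pow, mul_pow, hv, hu]
    field_simp
  have hlt : Y < X := by
    refine lt_of_pow_lt_pow_left₀ k hX0.le (sub_pos.1 ?_)
    rw [hXY]; positivity
  have hdiff : X - Y ≤ x * δ / (a * (y' : ℝ) ^ (k - 1)) := by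
    obtain ⟨m, rfl⟩ : ∃ m, k = m + 1 := ⟨k - 1, by omega⟩
    have h1 : Y ^ m * (X - Y) ≤ X ^ (m + 1) - Y ^ (m + 1) := by
      have := mul_le_mul_of_nonneg_right (pow_le_pow_left₀ hY0.le hlt.le m) hX0.le
      rw [pow_succ, pow_succ]; linarith
    rw [hXY] at h1
    rw [Nat.add_sub_cancel, le_div_iff₀ (by positivity)]
    have h2 : (x : ℝ) ^ m * ((X - Y) * (a * (y' : ℝ) ^ m)) ≤ (x : ℝ) ^ m * (x * δ) := by
      calc _ = Y ^ m * (X - Y) * a := by rw [hY, mul_pow]; ring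
        _ ≤ (x : ℝ) ^ (m + 1) * δ / a * a := mul_le_mul_of_nonneg_right h1 ra.le
        _ = _ := by field_simp; ring
    exact le_of_mul_le_mul_left h2 (by positivity)
  set E : ℝ := k ^ (2 * (p + 1)) * u ^ (p + 1) with hE
  have hE0 : 0 < E := by positivity
  have hsum : E * (y * x' * (num - ξ * den) + den * (X - Y)) =
      ((z₁ * (y * x') - z₂ * (y' * x) : ℤ) : ℝ) := by
    push_cast
    rw [hz₁, hz₂, hX, hY]; ring
  have hpos : 0 < y * x' * (num - ξ * den) + den * (X - Y) := by
    rcases hd0.eq_or_lt with h | h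
    · rw [← h]; simp only [mul_zero, sub_zero, zero_mul, add_zero]; positivity
    · have := mul_pos h (sub_pos.2 hlt)
      positivity
  have hone : 1 ≤ E * (y * x' * (num - ξ * den) + den * (X - Y)) := by
    have h := mul_pos hE0 hpos
    rw [hsum] at h ⊢
    exact_mod_cast h
  refine hone.trans ?_
  have h1 : E * ((v / u - 1) ^ 2 / 4) ^ (p + 1) = (k ^ 2 * δ ^ 2 / (4 * u)) ^ (p + 1) := by
    rw [hE, pow_mul, ← mul_pow, ← mul_pow, ← hvu]
    congr 1
    field_simp
  have h2 : E * (4 * (v / u)) ^ (p + 1) = (4 * k ^ 2 * v) ^ (p + 1) := by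
    rw [hE, pow_mul, ← mul_pow, ← mul_pow]
    congr 1
    field_simp
  calc _ = E * den * (X - Y) + E * (num - ξ * den) * (y * x') := by ring
    _ ≤ E * (4 * (v / u)) ^ (p + 1) * (x * δ / (a * (y' : ℝ) ^ (k - 1))) +
        E * (2 * ((v / u - 1) ^ 2 / 4) ^ (p + 1)) * (y * x') := by
      refine add_le_add (mul_le_mul (mul_le_mul_of_nonneg_left hd1 hE0.le) hdiff
        (sub_nonneg.2 hlt.le) (by positivity)) ?_
      exact mul_le_mul_of_nonneg_right (mul_le_mul_of_nonneg_left hr1 hE0.le) (by positivity)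
    _ = _ := by rw [h2, mul_left_comm E, h1]

lemma log_nine_eighths_le : Real.log (9 / 8) ≤ 0.1178 := by
  rw [Real.log_le_iff_le_exp (by norm_num)]
  have h := Real.quadratic_le_exp_of_nonneg (x := 0.02945) (by norm_num)
  have h2 : Real.exp 0.1178 = Real.exp 0.02945 ^ 4 := by
    rw [← Real.exp_nat_mul]; norm_num
  rw [h2]
  refine le_trans ?_ (pow_le_pow_left₀ (by norm_num) h 4)
  norm_num

lemma pow_succ_add_mul_pow_le {z : ℝ} (hz : 0 ≤ z) (m : ℕ) :
    z ^ (m + 1) + (m + 1) * z ^ m ≤ (z + 1) ^ (m + 1) := by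
  induction m with
  | zero => simp
  | succ m ih =>
    have h := mul_le_mul_of_nonneg_right ih (by linarith : 0 ≤ z + 1)
    rw [pow_succ (z + 1)]
    refine le_trans ?_ h
    have : 0 ≤ (m + 1 : ℝ) * z ^ m := by positivity
    push_cast
    rw [pow_succ, pow_succ]
    nlinarith

lemma pow_mul_pow_le_of_pow_sub_pow {k z w : ℕ} (hk : 1 ≤ k) (hzw : z < w) {m d s t : ℝ}
    (hm : 0 ≤ m) (hs : 0 ≤ s) (ht : 0 < t) (hd : (w : ℝ) ^ k - (z : ℝ) ^ k ≤ m * d) (hdt : d ≤ t)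
    (hst : s * t ≤ (z : ℝ) ^ k) : (k : ℝ) ^ k * s ^ (k - 1) ≤ m ^ k * t := by
  obtain ⟨j, rfl⟩ : ∃ j, k = j + 1 := ⟨k - 1, by omega⟩
  rw [Nat.add_sub_cancel]
  have h1 : ((j + 1 : ℕ) : ℝ) * (z : ℝ) ^ j ≤ m * t := by
    have h2 := pow_succ_add_mul_pow_le (Nat.cast_nonneg (α := ℝ) z) j
    have h3 : ((z : ℝ) + 1) ^ (j + 1) ≤ (w : ℝ) ^ (j + 1) :=
      pow_le_pow_left₀ (by positivity) (by exact_mod_cast hzw) _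
    have h4 := mul_le_mul_of_nonneg_left hdt hm
    push_cast
    linarith
  have h2 := pow_le_pow_left₀ (by positivity) h1 (j + 1)
  have h3 := pow_le_pow_left₀ (by positivity) hst j
  rw [mul_pow, ← pow_mul, mul_comm j, pow_mul, mul_pow m] at h2
  rw [mul_pow] at h3
  have h4 : (((j + 1 : ℕ) : ℝ) ^ (j + 1) * s ^ j) * t ^ j ≤ (m ^ (j + 1) * t) * t ^ j := by
    calc _ = ((j + 1 : ℕ) : ℝ) ^ (j + 1) * (s ^ j * t ^ j) := by ring
      _ ≤ ((j + 1 : ℕ) : ℝ) ^ (j + 1) * ((z : ℝ) ^ (j + 1)) ^ j :=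
        mul_le_mul_of_nonneg_left h3 (by positivity)
      _ ≤ _ := h2
      _ = _ := by ring
  exact le_of_mul_le_mul_right h4 (by positivity)

/-- If `n` shifts `a * b`, `a * b'`, `a' * b` and `a' * b'` to `k`-th powers, then `a' * b'` is much
larger than `a * b`. -/
lemma gap_principle {k : ℕ} (hk : 1 ≤ k) {a a' b b' x₁₁ x₁₂ x₂₁ x₂₂ : ℕ} {n : ℤ}
    (haa : a < a') (hbb : b < b') (hn : n ≠ 0)
    (h₁₁ : (a * b : ℤ) + n = (x₁₁ : ℤ) ^ k) (h₁₂ : (a * b' : ℤ) + n = (x₁₂ : ℤ) ^ k)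
    (h₂₁ : (a' * b : ℤ) + n = (x₂₁ : ℤ) ^ k) (h₂₂ : (a' * b' : ℤ) + n = (x₂₂ : ℤ) ^ k)
    (hnab : n < 0 → 9 * |n| ≤ a * b) :
    (k : ℝ) ^ k * (8 / 9 * (a * b)) ^ (k - 1) ≤ |(n : ℝ)| ^ k * (a' * b') := by
  have e₁₁ : (a * b : ℝ) + n = (x₁₁ : ℝ) ^ k := by exact_mod_cast h₁₁
  have e₁₂ : (a * b' : ℝ) + n = (x₁₂ : ℝ) ^ k := by exact_mod_cast h₁₂
  have e₂₁ : (a' * b : ℝ) + n = (x₂₁ : ℝ) ^ k := by exact_mod_cast h₂₁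
  have e₂₂ : (a' * b' : ℝ) + n = (x₂₂ : ℝ) ^ k := by exact_mod_cast h₂₂
  have ra : (0 : ℝ) ≤ a := by positivity
  have rb : (0 : ℝ) ≤ b := by positivity
  have raa : (a : ℝ) < a' := by exact_mod_cast haa
  have rbb : (b : ℝ) < b' := by exact_mod_cast hbb
  have hΔ : 0 < ((a' : ℝ) - a) * (b' - b) := mul_pos (by linarith) (by linarith)
  have hab' : (a * b : ℝ) ≤ a * b' := by gcongr
  have ha'b : (a * b : ℝ) ≤ a' * b := by gcongr
  have hab : (0 : ℝ) ≤ a * b := by positivity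
  have ha'b' : (0 : ℝ) < a' * b' := mul_pos (by linarith) (by linarith)
  have hkey : ((x₁₁ * x₂₂ : ℕ) : ℝ) ^ k - ((x₁₂ * x₂₁ : ℕ) : ℝ) ^ k =
      n * ((a' - a) * (b' - b)) := by
    push_cast
    rw [mul_pow, mul_pow, ← e₁₁, ← e₁₂, ← e₂₁, ← e₂₂]; ring
  rcases lt_or_gt_of_ne hn with hneg | hpos
  · have rneg : (n : ℝ) < 0 := by exact_mod_cast hneg
    have hnab' : 9 * |(n : ℝ)| ≤ a * b := by exact_mod_cast hnab hneg
    rw [abs_of_neg rneg] at hnab' ⊢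
    have hlt : x₁₁ * x₂₂ < x₁₂ * x₂₁ := by
      have h := mul_neg_of_neg_of_pos rneg hΔ
      rw [← hkey] at h
      exact_mod_cast lt_of_pow_lt_pow_left₀ k (by positivity) (sub_neg.1 h)
    have ht : 0 < (a' * b' : ℝ) + n := by nlinarith
    have h := pow_mul_pow_le_of_pow_sub_pow (s := a * b + n) (t := a' * b' + n)
      hk hlt (neg_nonneg.2 rneg.le) (by linarith) ht
      (by linarith : _ ≤ -(n : ℝ) * ((a' - a) * (b' - b))) (by nlinarith)
      (by push_cast; rw [mul_pow, ← e₁₁, ← e₂₂])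
    calc _ ≤ (k : ℝ) ^ k * (a * b + n) ^ (k - 1) := by gcongr; linarith
      _ ≤ _ := h
      _ ≤ _ := mul_le_mul_of_nonneg_left (by linarith) (pow_nonneg (by linarith) _)
  · have rpos : (0 : ℝ) < n := by exact_mod_cast hpos
    rw [abs_of_pos rpos]
    have hlt : x₁₂ * x₂₁ < x₁₁ * x₂₂ := by
      have h := mul_pos rpos hΔ
      rw [← hkey] at h
      exact_mod_cast lt_of_pow_lt_pow_left₀ k (by positivity) (sub_pos.1 h)
    have h := pow_mul_pow_le_of_pow_sub_pow (s := a * b) (t := a' * b')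
      hk hlt rpos.le hab ha'b' hkey.le (by nlinarith)
      (by push_cast; rw [mul_pow, ← e₁₂, ← e₂₁]; nlinarith)
    exact (mul_le_mul_of_nonneg_left (pow_le_pow_left₀ (by positivity) (by linarith) _)
      (by positivity)).trans h

lemma gap_principle_log {k : ℕ} (hk : 3 ≤ k) {a a' b b' x₁₁ x₁₂ x₂₁ x₂₂ : ℕ} {n : ℤ}
    (ha : 0 < a) (hb : 0 < b) (haa : a < a') (hbb : b < b') (hn : n ≠ 0)
    (h₁₁ : (a * b : ℤ) + n = (x₁₁ : ℤ) ^ k) (h₁₂ : (a * b' : ℤ) + n = (x₁₂ : ℤ) ^ k)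
    (h₂₁ : (a' * b : ℤ) + n = (x₂₁ : ℤ) ^ k) (h₂₂ : (a' * b' : ℤ) + n = (x₂₂ : ℤ) ^ k)
    (hnab : n < 0 → 9 * |n| ≤ a * b) (hnb : |n| ≤ b) :
    2 * (Real.log a + Real.log b) + 3 * Real.log k - 0.2356 - 3 * Real.log |(n : ℝ)| ≤
      Real.log a' + Real.log b' := by
  have h := gap_principle (by omega) haa hbb hn h₁₁ h₁₂ h₂₁ h₂₂ hnab
  have ra : (0 : ℝ) < a := by exact_mod_cast ha
  have rb : (0 : ℝ) < b := by exact_mod_cast hb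
  have ra' : (0 : ℝ) < a' := by exact_mod_cast ha.trans haa
  have rb' : (0 : ℝ) < b' := by exact_mod_cast hb.trans hbb
  have hk0 : (3 : ℝ) ≤ k := by exact_mod_cast hk
  have hkpos : (0 : ℝ) < k := by linarith
  have rn : 0 < |(n : ℝ)| := abs_pos.2 (by exact_mod_cast hn)
  have hA : 0 ≤ Real.log a := Real.log_nonneg (by exact_mod_cast ha)
  have hNb : Real.log |(n : ℝ)| ≤ Real.log b := Real.log_le_log rn (by exact_mod_cast hnb)
  have hK : 1 ≤ Real.log k := by
    rw [Real.le_log_iff_exp_le hkpos]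
    linarith [Real.exp_one_lt_d9]
  have h98 : Real.log (8 / 9) = -Real.log (9 / 8) := by rw [← Real.log_inv]; norm_num
  have hl := Real.log_le_log (by positivity) h
  rw [Real.log_mul (by positivity) (by positivity), Real.log_mul (by positivity) (by positivity),
    Real.log_pow, Real.log_pow, Real.log_pow, Real.log_mul (by positivity) (by positivity),
    Real.log_mul (by positivity) (by positivity), Real.log_mul (by positivity) (by positivity), h98,
    Nat.cast_sub (by omega)] at hl
  push_cast at hl
  have h9 := log_nine_eighths_le
  nlinarith [mul_nonneg (sub_nonneg.2 hk0) (by linarith :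
    0 ≤ Real.log k + (Real.log a + Real.log b - Real.log (9 / 8)) - Real.log |(n : ℝ)|)]

lemma log_mul_add_bounds {a b : ℕ} {n : ℤ} (ha : 0 < a) (hb : 0 < b)
    (h : 9 * |(n : ℝ)| ≤ a * b) :
    Real.log a + Real.log b - 0.1178 ≤ Real.log (a * b + n) ∧
      Real.log (a * b + n) ≤ Real.log a + Real.log b + 0.112 := by
  have ra : (0 : ℝ) < a := by exact_mod_cast ha
  have rb : (0 : ℝ) < b := by exact_mod_cast hb
  have hab : (0 : ℝ) < a * b := mul_pos ra rb
  have h1 := neg_abs_le (n : ℝ)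
  have h2 := le_abs_self (n : ℝ)
  have h98 : Real.log (8 / 9) = -Real.log (9 / 8) := by rw [← Real.log_inv]; norm_num
  have h9 := log_nine_eighths_le
  have h10 : Real.log (10 / 9) ≤ 0.112 :=
    (Real.log_le_sub_one_of_pos (by norm_num)).trans (by norm_num)
  have hl : Real.log (8 / 9 * (a * b)) ≤ Real.log (a * b + n) :=
    Real.log_le_log (by positivity) (by linarith)
  have hu : Real.log (a * b + n) ≤ Real.log (10 / 9 * (a * b)) :=
    Real.log_le_log (by linarith) (by linarith)
  rw [Real.log_mul (by norm_num) hab.ne', Real.log_mul ra.ne' rb.ne'] at hl hu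
  constructor <;> linarith

lemma log_dichotomy {k : ℕ} (hk : 3 ≤ k) (p : ℕ) {a a' b B x x' y y' : ℕ} {n : ℤ}
    (ha : 0 < a) (ha' : 0 < a') (hb : 0 < b) (hB : 0 < B)
    (hx0 : 0 < x) (hx0' : 0 < x') (hy0 : 0 < y) (hy0' : 0 < y')
    (hx : (a * b : ℤ) + n = (x : ℤ) ^ k) (hx' : (a' * b : ℤ) + n = (x' : ℤ) ^ k)
    (hy : (a * B : ℤ) + n = (y : ℤ) ^ k) (hy' : (a' * B : ℤ) + n = (y' : ℤ) ^ k)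
    (hnb : 9 * |n| ≤ b) (hnB : 9 * |n| ≤ B)
    {δ : ℝ} (hδ : δ = n * ((a' : ℝ) - a)) (hδ0 : 0 < δ) :
    2 / 3 * (Real.log a + Real.log a' + Real.log B) ≤
      (p + 1) * (Real.log a + Real.log a' + Real.log b + 2 * Real.log k + 1.5043) +
        Real.log b / 3 + Real.log δ + 0.9 ∨
    (p + 1) * (Real.log a + Real.log a' + Real.log b + 1.268 - 2 * Real.log k -
        2 * Real.log δ) ≤
      (Real.log a + Real.log a' + Real.log b + Real.log B) / 3 + 1.5 := by
  have key := one_le_add_of_mul_add_eq_pow (by omega) p ha ha' hx0 hx0' hy0 hy0' hx hx' hy hy' hδ hδ0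
  have hk3 : (3 : ℝ) ≤ k := by exact_mod_cast hk
  have hkpos : (0 : ℝ) < k := by linarith
  have ra : (1 : ℝ) ≤ a := by exact_mod_cast ha
  have ra' : (1 : ℝ) ≤ a' := by exact_mod_cast ha'
  have rb : (1 : ℝ) ≤ b := by exact_mod_cast hb
  have rB : (1 : ℝ) ≤ B := by exact_mod_cast hB
  have rx : (1 : ℝ) ≤ x := by exact_mod_cast hx0
  have rx' : (1 : ℝ) ≤ x' := by exact_mod_cast hx0'
  have ry : (1 : ℝ) ≤ y := by exact_mod_cast hy0
  have ry' : (1 : ℝ) ≤ y' := by exact_mod_cast hy0'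
  have rnb : 9 * |(n : ℝ)| ≤ b := by exact_mod_cast hnb
  have rnB : 9 * |(n : ℝ)| ≤ B := by exact_mod_cast hnB
  have hlog : ∀ {c d z : ℕ}, 0 < c → 0 < d → 9 * |(n : ℝ)| ≤ d →
      (c * d : ℤ) + n = (z : ℤ) ^ k →
      Real.log c + Real.log d - 0.1178 ≤ k * Real.log z ∧
        k * Real.log z ≤ Real.log c + Real.log d + 0.112 := fun {c d z} hc hd h he => by
    have he' : (c * d : ℝ) + n = (z : ℝ) ^ k := by exact_mod_cast he
    have hc' : (1 : ℝ) ≤ c := by exact_mod_cast hc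
    have := log_mul_add_bounds (n := n) hc hd (by nlinarith [(Nat.cast_nonneg d : (0 : ℝ) ≤ d)])
    rwa [he', Real.log_pow] at this
  obtain ⟨lx, ux⟩ := hlog ha hb rnb hx
  obtain ⟨lx', ux'⟩ := hlog ha' hb rnb hx'
  obtain ⟨ly, uy⟩ := hlog ha hB rnB hy
  obtain ⟨ly', uy'⟩ := hlog ha' hB rnB hy'
  have px := mul_nonneg (Real.log_nonneg rx) (sub_nonneg.2 hk3)
  have px' := mul_nonneg (Real.log_nonneg rx') (sub_nonneg.2 hk3)
  have py := mul_nonneg (Real.log_nonneg ry) (sub_nonneg.2 hk3)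
  have py' := mul_nonneg (Real.log_nonneg ry') (sub_nonneg.2 hk3)
  have l2 := Real.log_two_lt_d9
  have l2' := Real.log_two_gt_d9
  have l4 : Real.log 4 = 2 * Real.log 2 := by
    rw [show (4 : ℝ) = 2 ^ 2 by norm_num, Real.log_pow]; norm_num
  have hp : (0 : ℝ) ≤ (p : ℝ) + 1 := by positivity
  have half : Real.log (1 / 2) = -Real.log 2 := by rw [one_div, Real.log_inv]
  set T₁ : ℝ := (4 * k ^ 2 * (a' * (x : ℝ) ^ k)) ^ (p + 1) * (x * δ / (a * (y' : ℝ) ^ (k - 1)))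
    with hT₁
  set T₂ : ℝ := 2 * (k ^ 2 * δ ^ 2 / (4 * (a * (x' : ℝ) ^ k))) ^ (p + 1) * (y * x') with hT₂
  rcases le_or_gt (1 / 2) T₁ with h | h
  · left
    have h1 := Real.log_le_log (by norm_num) h
    rw [half, hT₁, Real.log_mul (by positivity) (by positivity), Real.log_pow,
      Real.log_mul (by positivity) (by positivity), Real.log_mul (by positivity) (by positivity),
      Real.log_mul (by positivity) (by positivity), Real.log_pow, Real.log_pow,
      Real.log_div (by positivity) (by positivity), Real.log_mul (by positivity) (by positivity),
      Real.log_mul (by positivity) (by positivity), Real.log_pow, Nat.cast_sub (by omega), l4] at h1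
    push_cast at h1
    have h2 : ((p : ℝ) + 1) * (2 * Real.log 2 + 2 * Real.log k + (Real.log a' + k * Real.log x)) ≤
        (p + 1) * (Real.log a + Real.log a' + Real.log b + 2 * Real.log k + 1.5043) :=
      mul_le_mul_of_nonneg_left (by linarith) hp
    linarith
  · right
    have h1 := Real.log_le_log (by norm_num) (by linarith : 1 / 2 ≤ T₂)
    rw [half, hT₂, Real.log_mul (by positivity) (by positivity),
      Real.log_mul (by positivity) (by positivity), Real.log_pow,
      Real.log_div (by positivity) (by positivity), Real.log_mul (by positivity) (by positivity),
      Real.log_mul (by positivity) (by positivity), Real.log_mul (by positivity) (by positivity),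
      Real.log_mul (by positivity) (by positivity), Real.log_pow, Real.log_pow, Real.log_pow,
      l4] at h1
    push_cast at h1
    have h2 : ((p : ℝ) + 1) * (2 * Real.log k + 2 * Real.log δ -
          (2 * Real.log 2 + (Real.log a + k * Real.log x'))) ≤
        (p + 1) * (-(Real.log a + Real.log a' + Real.log b + 1.268 - 2 * Real.log k -
        2 * Real.log δ)) :=
      mul_le_mul_of_nonneg_left (by linarith) hp
    linarith

/-- The numerical inequalities between logarithms of the sizes which make the Padé bound
contradict the gap principle. -/
lemma log_ratio_bounds {A₁ A₂ A₃ b₁ b₂ b₃ b₄ b₅ b₆ b₇ N K k : ℝ}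
    (h0 : 0 ≤ A₁) (h2 : A₂ ≤ A₃) (h3 : A₃ ≤ b₁) (hN : N = 0 ∨ 0.693 ≤ N)
    (hb : 17 * N + 0.693 ≤ b₁) (hb4 : 1.386 ≤ b₁) (hbk : 0.693 * k ≤ 2 * b₁) (hK : 1.098 ≤ K)
    (hK4 : K ≤ k / 4 + 0.3864) (hK16 : K ≤ k / 16 + 1.7728)
    (g₁₂ : 2 * (A₁ + b₂) + 3 * K - 0.2356 - 3 * N ≤ A₂ + b₃)
    (g₂₁ : 2 * (A₂ + b₁) + 3 * K - 0.2356 - 3 * N ≤ A₃ + b₂)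
    (g₂₂ : 2 * (A₂ + b₂) + 3 * K - 0.2356 - 3 * N ≤ A₃ + b₃)
    (g₁₃ : 2 * (A₁ + b₃) + 3 * K - 0.2356 - 3 * N ≤ A₂ + b₄)
    (g₁₄ : 2 * (A₁ + b₄) + 3 * K - 0.2356 - 3 * N ≤ A₂ + b₅)
    (g₁₅ : 2 * (A₁ + b₅) + 3 * K - 0.2356 - 3 * N ≤ A₂ + b₆)
    (g₁₆ : 2 * (A₁ + b₆) + 3 * K - 0.2356 - 3 * N ≤ A₂ + b₇) :
    ∃ ρ : ℝ, 0 ≤ ρ ∧ A₁ + A₂ + b₃ + 2 * K + 1.5043 ≤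
        ρ * (A₁ + A₂ + b₃ + 1.268 - 2 * K - 2 * (N + A₂)) ∧
      ρ * ((A₁ + A₂ + b₃ + b₇) / 3 + 1.5) + (A₁ + A₂ + b₃ + 2 * K + 1.5043) +
        b₃ / 3 + (N + A₂) + 0.9 < 2 / 3 * (A₁ + A₂ + b₇) := by
  rcases hN with hN | hN
  · exact ⟨1.53, by norm_num, by linarith, by linarith⟩
  · exact ⟨1.49, by norm_num, by linarith, by linarith⟩

lemma not_forall_or_of_ratio {P Q ρ c d : ℝ} (hQ : 0 < Q) (hρ : 0 ≤ ρ) (hQP : Q ≤ ρ * P)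
    (hc : 0 ≤ c) (h : ρ * c + Q < d) : ¬ ∀ p : ℕ, d ≤ (p + 1) * Q ∨ (p + 1) * P ≤ c := by
  intro H
  have hP : 0 < P := pos_of_mul_pos_right (hQ.trans_le hQP) hρ
  have hf := Nat.floor_le (div_nonneg hc hP.le)
  have hlt := Nat.lt_floor_add_one (c / P)
  rw [le_div_iff₀ hP] at hf
  rw [div_lt_iff₀ hP] at hlt
  rcases H ⌊c / P⌋₊ with h1 | h1
  · have h2 := mul_le_mul_of_nonneg_left hQP (Nat.cast_nonneg (α := ℝ) ⌊c / P⌋₊)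
    have h3 := mul_le_mul_of_nonneg_left hf hρ
    linarith
  · linarith


lemma log_natCast_bounds {k : ℕ} (hk : 3 ≤ k) :
    1.098 ≤ Real.log k ∧ Real.log k ≤ k / 4 + 0.3864 ∧ Real.log k ≤ k / 16 + 1.7728 := by
  have hk3 : (3 : ℝ) ≤ k := by exact_mod_cast hk
  have hpow : ∀ j : ℕ, Real.log k ≤ k / 2 ^ j - 1 + j * Real.log 2 := fun j => by
    have h := Real.log_le_sub_one_of_pos (by positivity : (0 : ℝ) < k / 2 ^ j)
    rw [Real.log_div (by positivity) (by positivity), Real.log_pow] at h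
    linarith
  have h2 := hpow 2
  have h4 := hpow 4
  have l2 := Real.log_two_lt_d9
  have l3 := Real.log_three_gt_d9
  have := Real.log_le_log (by norm_num) hk3
  norm_num at h2 h4
  exact ⟨by linarith, by linarith, by linarith⟩

lemma size_bounds {k a b z : ℕ} {n : ℤ} (hk : 3 ≤ k) (hn : n ≠ 0) (ha : 0 < a) (hz : 0 < z)
    (hab : a + 2 ≤ b) (hnb : 2 * |n| ^ 17 ≤ (b : ℤ)) (h : (a * b : ℤ) + n = (z : ℤ) ^ k) :
    4 ≤ b ∧ 2 ^ k ≤ b ^ 2 ∧ |n| ≤ b ∧ (n < 0 → 9 * |n| ≤ a * b) := by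
  have hm1 : 1 ≤ |n| := Int.one_le_abs hn
  have hm : 2 * |n| ≤ b := by nlinarith [le_self_pow₀ hm1 (by norm_num : 17 ≠ 0)]
  have ha' : (1 : ℤ) ≤ a := by exact_mod_cast ha
  have hab' : (a : ℤ) + 2 ≤ b := by exact_mod_cast hab
  have hz' : (1 : ℤ) ≤ z := by exact_mod_cast hz
  have hl := neg_abs_le n
  have hu := le_abs_self n
  have hz2 : (2 : ℤ) ≤ z := by
    by_contra! hlt
    have : (z : ℤ) = 1 := by omega
    rw [this, one_pow] at h
    nlinarith
  have hpow : (2 : ℤ) ^ k ≤ (z : ℤ) ^ k := pow_le_pow_left₀ (by norm_num) hz2 k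
  have h8 : (8 : ℤ) ≤ 2 ^ k := by
    calc (8 : ℤ) = 2 ^ 3 := by norm_num
      _ ≤ 2 ^ k := pow_le_pow_right₀ (by norm_num) hk
  have hub : 2 * (z : ℤ) ^ k ≤ 2 * ((b - 2) * b) + b := by nlinarith
  refine ⟨?_, ?_, by linarith, fun hneg => ?_⟩
  · have : (4 : ℤ) ≤ b := by
      by_contra! hlt
      nlinarith
    exact_mod_cast this
  · have : (2 : ℤ) ^ k ≤ (b : ℤ) ^ 2 := by nlinarith
    exact_mod_cast this
  · rcases hm1.eq_or_lt with h1 | h1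
    · rw [abs_of_neg hneg] at h1 ⊢
      linarith
    · have h16 : (2 : ℤ) ^ 16 ≤ |n| ^ 16 := pow_le_pow_left₀ (by norm_num) h1 16
      have h17 : |n| ^ 17 = |n| ^ 16 * |n| := pow_succ _ _
      nlinarith

end

/-- Corollary 2.2: there are no positive integers `a₁ < a₂ < a₃ ≤ b₁ < ⋯ < b₇`
with `2|n|^17 ≤ b₁` such that every `aᵢbⱼ + n` is a `k`-th power. -/
theorem no_K37_above_threshold (k : ℕ) (n : ℤ) (hk : 3 ≤ k) (hn : n ≠ 0) :
    ¬ ∃ (a : Fin 3 → ℕ) (b : Fin 7 → ℕ),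
      (∀ i, 0 < a i) ∧ (∀ j, 0 < b j) ∧
      StrictMono a ∧ StrictMono b ∧
      a 2 ≤ b 0 ∧ 2 * |n| ^ 17 ≤ (b 0 : ℤ) ∧
      ∀ i j, ∃ x : ℕ, 0 < x ∧ (a i * b j : ℤ) + n = (x : ℤ) ^ k := by
  rintro ⟨a, b, ha, hb, hamono, hbmono, hab, hnb, hpow⟩
  choose x hx0 hx using hpow
  have a01 : a 0 < a 1 := hamono (by decide)
  have a12 : a 1 < a 2 := hamono (by decide)
  obtain ⟨hb4, hkb, hmb, hmab⟩ := size_bounds hk hn (ha 0) (hx0 0 0) (by omega) hnb (hx 0 0)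
  have hbmin : ∀ j, (b 0 : ℤ) ≤ b j := fun j => by exact_mod_cast hbmono.monotone (Fin.zero_le j)
  have hamin : ∀ i, (a 0 : ℤ) ≤ a i := fun i => by exact_mod_cast hamono.monotone (Fin.zero_le i)
  have gap : ∀ (i i' : Fin 3) (j j' : Fin 7), i < i' → j < j' →
      2 * (Real.log (a i) + Real.log (b j)) + 3 * Real.log k - 0.2356 - 3 * Real.log |(n : ℝ)| ≤
        Real.log (a i') + Real.log (b j') := fun i i' j j' hi hj =>
    gap_principle_log hk (ha i) (hb j) (hamono hi) (hbmono hj) hn (hx _ _) (hx _ _) (hx _ _)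
      (hx _ _) (fun h => (hmab h).trans (mul_le_mul (hamin i) (hbmin j) (by positivity)
        (by positivity))) (hmb.trans (hbmin j))
  have hm1 : (1 : ℝ) ≤ |(n : ℝ)| := by exact_mod_cast Int.one_le_abs hn
  have ra : ∀ i, (0 : ℝ) < a i := fun i => by exact_mod_cast ha i
  have rb : ∀ j, (0 : ℝ) < b j := fun j => by exact_mod_cast hb j
  have l2 := Real.log_two_gt_d9
  have l2' := Real.log_two_lt_d9
  have hA0 : 0 ≤ Real.log (a 0) := Real.log_nonneg (by exact_mod_cast ha 0)
  have hA01 : Real.log (a 0) ≤ Real.log (a 1) := Real.log_le_log (ra 0) (by exact_mod_cast a01.le)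
  have hA12 : Real.log (a 1) ≤ Real.log (a 2) := Real.log_le_log (ra 1) (by exact_mod_cast a12.le)
  have hA2b : Real.log (a 2) ≤ Real.log (b 0) := Real.log_le_log (ra 2) (by exact_mod_cast hab)
  have hN0 : 0 ≤ Real.log |(n : ℝ)| := Real.log_nonneg hm1
  have hN : Real.log |(n : ℝ)| = 0 ∨ 0.693 ≤ Real.log |(n : ℝ)| := by
    rcases (Int.one_le_abs hn).eq_or_lt with h | h
    · left
      have : |(n : ℝ)| = 1 := by exact_mod_cast h.symm
      rw [this, Real.log_one]
    · right
      have : (2 : ℝ) ≤ |(n : ℝ)| := by exact_mod_cast h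
      linarith [Real.log_le_log (by norm_num) this]
  have hNb : 17 * Real.log |(n : ℝ)| + 0.693 ≤ Real.log (b 0) := by
    have h : 2 * |(n : ℝ)| ^ 17 ≤ b 0 := by exact_mod_cast hnb
    have := Real.log_le_log (by positivity) h
    rw [Real.log_mul (by positivity) (by positivity), Real.log_pow] at this
    push_cast at this
    linarith
  have hb4' : 1.386 ≤ Real.log (b 0) := by
    have h : (2 : ℝ) ^ 2 ≤ b 0 := by norm_num; exact_mod_cast hb4
    have := Real.log_le_log (by positivity) h
    rw [Real.log_pow] at this
    push_cast at this
    linarith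
  have hkb' : 0.693 * (k : ℝ) ≤ 2 * Real.log (b 0) := by
    have h : (2 : ℝ) ^ k ≤ (b 0 : ℝ) ^ 2 := by exact_mod_cast hkb
    have := Real.log_le_log (by positivity) h
    rw [Real.log_pow, Real.log_pow] at this
    push_cast at this
    nlinarith [(Nat.cast_nonneg k : (0 : ℝ) ≤ k)]
  obtain ⟨hK, hK4, hK16⟩ := log_natCast_bounds hk
  obtain ⟨ρ, hρ, hQP, hlt⟩ := log_ratio_bounds hA0 hA12 hA2b hN hNb hb4' hkb' hK hK4 hK16
    (gap 0 1 1 2 (by decide) (by decide)) (gap 1 2 0 1 (by decide) (by decide))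
    (gap 1 2 1 2 (by decide) (by decide)) (gap 0 1 2 3 (by decide) (by decide))
    (gap 0 1 3 4 (by decide) (by decide)) (gap 0 1 4 5 (by decide) (by decide))
    (gap 0 1 5 6 (by decide) (by decide))
  have hb02 : Real.log (b 0) ≤ Real.log (b 2) := Real.log_le_log (rb 0) (by exact_mod_cast hbmin 2)
  have hb26 : (b 2 : ℤ) ≤ b 6 := by exact_mod_cast hbmono.monotone (by decide)
  have h9 : 9 * |n| ≤ b 2 := by
    have h1 := gap 1 2 1 2 (by decide) (by decide)
    have h2 := gap 1 2 0 1 (by decide) (by decide)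
    have l3 := Real.log_three_lt_d9
    have : Real.log (3 ^ 2 * |(n : ℝ)|) ≤ Real.log (b 2) := by
      rw [Real.log_mul (by positivity) (by positivity), Real.log_pow]
      push_cast
      linarith
    rw [Real.log_le_log_iff (by positivity) (rb 2)] at this
    norm_num at this
    exact_mod_cast this
  have hb6 : 0 ≤ Real.log (b 6) := Real.log_nonneg (by exact_mod_cast hb 6)
  refine not_forall_or_of_ratio (by linarith) hρ hQP (c := (Real.log (a 0) + Real.log (a 1) +
      Real.log (b 2) + Real.log (b 6)) / 3 + 1.5) (by linarith)
    (d := 2 / 3 * (Real.log (a 0) + Real.log (a 1) + Real.log (b 6)) - Real.log (b 2) / 3 -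
      (Real.log |(n : ℝ)| + Real.log (a 1)) - 0.9) (by linarith) fun p => ?_
  have main : ∃ δ : ℝ, Real.log δ ≤ Real.log |(n : ℝ)| + Real.log (a 1) ∧
      (2 / 3 * (Real.log (a 0) + Real.log (a 1) + Real.log (b 6)) ≤
        (p + 1) * (Real.log (a 0) + Real.log (a 1) + Real.log (b 2) + 2 * Real.log k + 1.5043) +
          Real.log (b 2) / 3 + Real.log δ + 0.9 ∨
      (p + 1) * (Real.log (a 0) + Real.log (a 1) + Real.log (b 2) + 1.268 - 2 * Real.log k -
          2 * Real.log δ) ≤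
        (Real.log (a 0) + Real.log (a 1) + Real.log (b 2) + Real.log (b 6)) / 3 + 1.5) := by
    have hd : (0 : ℝ) < a 1 - a 0 := sub_pos.2 (by exact_mod_cast a01)
    have hδ : Real.log (|(n : ℝ)| * (a 1 - a 0)) ≤ Real.log |(n : ℝ)| + Real.log (a 1) := by
      rw [Real.log_mul (by positivity) hd.ne']
      have := Real.log_le_log hd (by linarith [ra 0] : (a 1 - a 0 : ℝ) ≤ a 1)
      linarith
    refine ⟨_, hδ, ?_⟩
    rcases lt_or_gt_of_ne hn with hneg | hpos
    · have rneg : (n : ℝ) < 0 := by exact_mod_cast hneg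
      have h := log_dichotomy hk p (ha 1) (ha 0) (hb 2) (hb 6) (hx0 _ _) (hx0 _ _) (hx0 _ _)
        (hx0 _ _) (hx _ _) (hx _ _) (hx _ _) (hx _ _) h9 (h9.trans hb26)
        (δ := |(n : ℝ)| * (a 1 - a 0)) (by rw [abs_of_neg rneg]; ring) (by positivity)
      rwa [add_comm (Real.log (a 1))] at h
    · have rpos : (0 : ℝ) < n := by exact_mod_cast hpos
      exact log_dichotomy hk p (ha 0) (ha 1) (hb 2) (hb 6) (hx0 _ _) (hx0 _ _) (hx0 _ _)
        (hx0 _ _) (hx _ _) (hx _ _) (hx _ _) (hx _ _) h9 (h9.trans hb26)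
        (by rw [abs_of_pos rpos]) (by positivity)
  obtain ⟨δ, hδ, h | h⟩ := main
  · left; linarith
  · right
    refine le_trans (mul_le_mul_of_nonneg_left ?_ (by positivity)) h
    linarith
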